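/- Let b = -1 + a/log T with a > 0 fixed and T large. Then uniformly for b ≤ Re(s) ≤ 2, |G(s)| ≤ exp(B·log T/log log T) for some constant B depending only on a; in particular G(s) ≪_ε T^ε. -/

import Mathlib

open scoped BigOperators

noncomputable section

/-- `G(s) = ∏_{p>2}(1 + 2/((p-2)(p^{s+1}+1)))`. -/
def singG (s : ℂ) : ℂ :=
  ∏' p : {p : ℕ // p.Prime ∧ 2 < p},
    (1 + 2 / (((p.1 : ℂ) - 2) * ((p.1 : ℂ) ^ (s + 1) + 1)))

open Real in
lemma sg_block (k : ℕ) (hk : 1 ≤ k) :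
    ∑ p ∈ (Finset.Ico (2 ^ k) (2 ^ (k + 1))).filter Nat.Prime, 1 / ((p : ℝ) * Real.log p)
      ≤ 8 / (k : ℝ) ^ 2 := by
  have hk' : (0 : ℝ) < k := by exact_mod_cast hk
  have hl2 : 0 < Real.log 2 := Real.log_pos (by norm_num)
  set c : ℝ := 1 / (2 ^ k * (k * Real.log 2) ^ 2) with hc
  have hcpos : 0 < c := by positivity
  have h1 : ∀ p ∈ (Finset.Ico (2 ^ k) (2 ^ (k + 1))).filter Nat.Prime,
      1 / ((p : ℝ) * Real.log p) ≤ c * Real.log p := by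
    intro p hp
    simp only [Finset.mem_filter, Finset.mem_Ico] at hp
    have hpk : (2 : ℝ) ^ k ≤ p := by exact_mod_cast hp.1.1
    have hlp : (k : ℝ) * Real.log 2 ≤ Real.log p := by
      rw [← Real.log_pow]
      exact Real.log_le_log (by positivity) hpk
    have hlpos : 0 < Real.log p := lt_of_lt_of_le (by positivity) hlp
    have hppos : (0 : ℝ) < p := lt_of_lt_of_le (by positivity) hpk
    have : 1 / ((p : ℝ) * Real.log p) = 1 / ((p : ℝ) * Real.log p ^ 2) * Real.log p := by
      field_simp
    rw [this, hc]
    gcongr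
  have h2 : ∑ p ∈ (Finset.Ico (2 ^ k) (2 ^ (k + 1))).filter Nat.Prime, Real.log p
      ≤ Chebyshev.theta ((2 : ℝ) ^ (k + 1)) := by
    unfold Chebyshev.theta
    apply Finset.sum_le_sum_of_subset_of_nonneg
    · intro p hp
      simp only [Finset.mem_filter, Finset.mem_Ico] at hp
      simp only [Finset.mem_filter, Finset.mem_Ioc]
      refine ⟨⟨hp.2.pos, Nat.le_floor ?_⟩, hp.2⟩
      exact_mod_cast hp.1.2.le
    · intro p _ _
      exact Real.log_natCast_nonneg p
  have h3 := Chebyshev.theta_le_log4_mul_x (x := (2 : ℝ) ^ (k + 1)) (by positivity)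
  have h4 : Real.log 4 = 2 * Real.log 2 := by
    rw [show (4 : ℝ) = 2 ^ 2 by norm_num, Real.log_pow]; norm_num
  calc _ ≤ ∑ p ∈ (Finset.Ico (2 ^ k) (2 ^ (k + 1))).filter Nat.Prime, c * Real.log p :=
        Finset.sum_le_sum h1
    _ = c * ∑ p ∈ (Finset.Ico (2 ^ k) (2 ^ (k + 1))).filter Nat.Prime, Real.log p := by
        rw [Finset.mul_sum]
    _ ≤ c * (Real.log 4 * 2 ^ (k + 1)) := by gcongr; exact h2.trans h3
    _ = 4 / ((k : ℝ) ^ 2 * Real.log 2) := by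
        rw [h4, hc]; field_simp; ring
    _ ≤ 8 / (k : ℝ) ^ 2 := by
        have : 1 / 2 ≤ Real.log 2 := by linarith [Real.log_two_gt_d9]
        rw [div_le_div_iff₀ (by positivity) (by positivity)]
        nlinarith [sq_nonneg (k : ℝ)]

lemma sg_tail (k : ℕ) (hk : 2 ≤ k) (N : ℕ) (hN : k ≤ N) :
    ∑ p ∈ (Finset.Ico (2 ^ k) (2 ^ N)).filter Nat.Prime, 1 / ((p : ℝ) * Real.log p)
      ≤ 8 * (1 / ((k : ℝ) - 1) - 1 / ((N : ℝ) - 1)) := by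
  induction N, hN using Nat.le_induction with
  | base => simp
  | succ N hN ih =>
    have hsplit : (Finset.Ico (2 ^ k) (2 ^ (N + 1))).filter Nat.Prime =
        (Finset.Ico (2 ^ k) (2 ^ N)).filter Nat.Prime ∪
        (Finset.Ico (2 ^ N) (2 ^ (N + 1))).filter Nat.Prime := by
      rw [← Finset.filter_union, Finset.Ico_union_Ico_eq_Ico]
      · exact Nat.pow_le_pow_right (by norm_num) hN
      · exact Nat.pow_le_pow_right (by norm_num) (by omega)
    rw [hsplit, Finset.sum_union]
    · have hb := sg_block N (by omega)
      have hN2 : (2 : ℝ) ≤ N := by exact_mod_cast (hk.trans hN)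
      have : 8 / (N : ℝ) ^ 2 ≤ 8 * (1 / ((N : ℝ) - 1) - 1 / N) := by
        have h0 : (0 : ℝ) < N - 1 := by linarith
        have : 1 / ((N : ℝ) - 1) - 1 / N = 1 / ((N - 1) * N) := by
          field_simp; ring
        rw [this, mul_one_div]
        apply div_le_div_of_nonneg_left (by norm_num) (by positivity)
        nlinarith
      push_cast
      rw [add_sub_cancel_right]
      linarith
    · rw [Finset.disjoint_left]
      intro p hp hq
      simp only [Finset.mem_filter, Finset.mem_Ico] at hp hq
      omega

lemma sg_tail' (k : ℕ) (hk : 2 ≤ k) (S : Finset ℕ) (hS : ∀ p ∈ S, p.Prime ∧ 2 ^ k ≤ p) :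
    ∑ p ∈ S, 1 / ((p : ℝ) * Real.log p) ≤ 8 / ((k : ℝ) - 1) := by
  set N := max k (S.sup id) with hNdef
  have hkN : k ≤ N := le_max_left _ _
  have h := sg_tail k hk N hkN
  have hk2 : (2 : ℝ) ≤ k := by exact_mod_cast hk
  have hN2 : (2 : ℝ) ≤ N := by exact_mod_cast hk.trans hkN
  have hpos : 0 ≤ 1 / ((N : ℝ) - 1) := one_div_nonneg.mpr (by linarith)
  have h2 : ∑ p ∈ S, 1 / ((p : ℝ) * Real.log p) ≤
      ∑ p ∈ (Finset.Ico (2 ^ k) (2 ^ N)).filter Nat.Prime, 1 / ((p : ℝ) * Real.log p) := by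
    apply Finset.sum_le_sum_of_subset_of_nonneg
    · intro p hp
      simp only [Finset.mem_filter, Finset.mem_Ico]
      refine ⟨⟨(hS p hp).2, ?_⟩, (hS p hp).1⟩
      have : p ≤ S.sup id := Finset.le_sup (f := id) hp
      exact lt_of_le_of_lt (this.trans (le_max_right _ _)) Nat.lt_two_pow_self
    · intro p _ _
      have := Real.log_natCast_nonneg p
      positivity
  have h3 : 8 / ((k : ℝ) - 1) = 8 * (1 / ((k : ℝ) - 1)) := by ring
  linarith

/-- the finite product bound -/
lemma sg_prod (K : ℝ) (hK0 : 0 < K) (hK : 16 ≤ Real.log K) (S : Finset ℕ)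
    (hS : ∀ p ∈ S, p.Prime ∧ 2 < p) :
    ∏ p ∈ S, (1 + K / ((p : ℝ) * Real.log p)) ≤ Real.exp (72 * K / Real.log K) := by
  set l := Real.log K with hl
  have hKe : K = Real.exp l := (Real.exp_log hK0).symm
  set k := ⌊l / 4⌋₊ with hk
  have hk1 : (k : ℝ) ≤ l / 4 := Nat.floor_le (by linarith)
  have hk2 : l / 4 < k + 1 := Nat.lt_floor_add_one _
  have hk3 : 2 ≤ k := Nat.le_floor (by push_cast; linarith)
  have hlog : ∀ p ∈ S, 1 ≤ Real.log p := by
    intro p hp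
    have h3 : (3 : ℝ) ≤ p := by exact_mod_cast (hS p hp).2
    rw [Real.le_log_iff_exp_le (by linarith)]
    linarith [Real.exp_one_lt_d9]
  have hp3 : ∀ p ∈ S, (3 : ℝ) ≤ p := by
    intro p hp
    exact_mod_cast (hS p hp).2
  set f : ℕ → ℝ := fun p => if p < 2 ^ k then 2 * Real.exp (l / 2)
    else K * (1 / ((p : ℝ) * Real.log p)) with hf
  have hfac : ∀ p ∈ S, 1 + K / ((p : ℝ) * Real.log p) ≤ Real.exp (f p) := by
    intro p hp
    have a1 := hlog p hp
    have a2 := hp3 p hp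
    simp only [hf]
    split_ifs with h
    · have : K / ((p : ℝ) * Real.log p) ≤ K := div_le_self hK0.le (by nlinarith)
      have e1 := Real.add_one_le_exp (Real.exp (l / 2))
      have e0 := Real.exp_pos (l / 2)
      have e2 : Real.exp (2 * Real.exp (l / 2)) = Real.exp (Real.exp (l / 2)) ^ 2 := by
        rw [← Real.exp_nat_mul]; norm_num
      have e3 : K = Real.exp (l / 2) ^ 2 := by
        rw [← Real.exp_nat_mul, hKe]; congr 1; push_cast; ring
      rw [e2]
      nlinarith
    · rw [mul_one_div, add_comm]
      exact Real.add_one_le_exp _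
  have hsum : ∑ p ∈ S, f p ≤ 72 * K / l := by
    rw [← Finset.sum_filter_add_sum_filter_not S (fun p => p < 2 ^ k)]
    have s1 : ∑ p ∈ S.filter (fun p => p < 2 ^ k), f p ≤ 8 * K / l := by
      have : ∑ p ∈ S.filter (fun p => p < 2 ^ k), f p
          = ((S.filter (fun p => p < 2 ^ k)).card : ℝ) * (2 * Real.exp (l / 2)) := by
        rw [← nsmul_eq_mul, ← Finset.sum_const]
        apply Finset.sum_congr rfl
        intro p hp
        simp only [hf, if_pos (Finset.mem_filter.mp hp).2]
      rw [this]
      have hcard : ((S.filter (fun p => p < 2 ^ k)).card : ℝ) ≤ Real.exp (l / 4) := by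
        have c1 : (S.filter (fun p => p < 2 ^ k)).card ≤ 2 ^ k := by
          refine le_of_le_of_eq (Finset.card_le_card ?_) (Finset.card_range (2 ^ k))
          intro p hp
          exact Finset.mem_range.mpr (Finset.mem_filter.mp hp).2
        have c2 : (2 : ℝ) ^ k ≤ Real.exp (l / 4) := by
          calc (2 : ℝ) ^ k ≤ Real.exp 1 ^ k := by
                gcongr; linarith [Real.exp_one_gt_d9]
            _ = Real.exp k := by rw [← Real.exp_nat_mul, mul_one]
            _ ≤ _ := Real.exp_le_exp.mpr hk1
        refine le_trans ?_ c2
        exact_mod_cast c1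
      have e4 : l ≤ 4 * Real.exp (l / 4) := by linarith [Real.add_one_le_exp (l / 4)]
      have e5 : K = Real.exp (l / 4) ^ 4 := by
        rw [← Real.exp_nat_mul, hKe]; congr 1; push_cast; ring
      have e6 : Real.exp (l / 2) = Real.exp (l / 4) ^ 2 := by
        rw [← Real.exp_nat_mul]; congr 1; push_cast; ring
      have e0 := Real.exp_pos (l / 4)
      rw [e6, le_div_iff₀ (by linarith), e5]
      set E := Real.exp (l / 4)
      calc _ ≤ E * (2 * E ^ 2) * (4 * E) := by gcongr
        _ = _ := by ring
    have s2 : ∑ p ∈ S.filter (fun p => ¬ p < 2 ^ k), f p ≤ 64 * K / l := by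
      have : ∑ p ∈ S.filter (fun p => ¬ p < 2 ^ k), f p
          = K * ∑ p ∈ S.filter (fun p => ¬ p < 2 ^ k), 1 / ((p : ℝ) * Real.log p) := by
        rw [Finset.mul_sum]
        apply Finset.sum_congr rfl
        intro p hp
        simp only [hf, if_neg (Finset.mem_filter.mp hp).2]
      rw [this]
      have t := sg_tail' k hk3 (S.filter (fun p => ¬ p < 2 ^ k)) (by
        intro p hp
        rw [Finset.mem_filter] at hp
        exact ⟨(hS p hp.1).1, not_lt.mp hp.2⟩)
      have t2 : 8 / ((k : ℝ) - 1) ≤ 64 / l := by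
        rw [div_le_div_iff₀ (by linarith) (by linarith)]
        linarith
      calc _ ≤ K * (64 / l) := by gcongr; exact t.trans t2
        _ = _ := by ring
    have : 72 * K / l = 8 * K / l + 64 * K / l := by ring
    linarith
  calc _ ≤ ∏ p ∈ S, Real.exp (f p) := by
        apply Finset.prod_le_prod _ hfac
        intro p hp
        have a1 := hlog p hp
        have a2 := hp3 p hp
        positivity
    _ = Real.exp (∑ p ∈ S, f p) := (Real.exp_sum _ _).symm
    _ ≤ _ := Real.exp_le_exp.mpr hsum

lemma sg_factor (δ : ℝ) (hδ : 0 < δ) (s : ℂ) (hs : δ ≤ s.re + 1) (p : ℕ) (hp : 2 < p) :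
    ‖(1 + 2 / (((p : ℂ) - 2) * ((p : ℂ) ^ (s + 1) + 1)) : ℂ)‖
      ≤ 1 + (6 / δ) / ((p : ℝ) * Real.log p) := by
  have h3 : (3 : ℝ) ≤ p := by exact_mod_cast hp
  have hl : 0 < Real.log p := Real.log_pos (by linarith)
  have hn : ‖((p : ℂ) ^ (s + 1))‖ = (p : ℝ) ^ (s.re + 1) := by
    rw [Complex.norm_natCast_cpow_of_pos (by omega)]; simp
  have hge : 1 + δ * Real.log p ≤ (p : ℝ) ^ (s.re + 1) := by
    rw [Real.rpow_def_of_pos (by linarith)]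
    have := Real.add_one_le_exp (Real.log p * (s.re + 1))
    nlinarith
  have hlow : δ * Real.log p ≤ ‖((p : ℂ) ^ (s + 1) + 1)‖ := by
    have := norm_sub_le_norm_add ((p : ℂ) ^ (s + 1)) 1
    rw [hn, norm_one] at this
    linarith
  have hp2 : ‖((p : ℂ) - 2)‖ = (p : ℝ) - 2 := by
    have : ((p : ℂ) - 2) = (((p : ℝ) - 2 : ℝ) : ℂ) := by push_cast; rfl
    rw [this, Complex.norm_real, Real.norm_of_nonneg (by linarith)]
  refine (norm_add_le _ _).trans ?_
  rw [norm_one, norm_div, norm_mul, hp2]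
  have : ‖(2 : ℂ)‖ = 2 := by simp
  rw [this]
  have hd : 0 < δ * Real.log p := by positivity
  have : (6 / δ) / ((p : ℝ) * Real.log p) = 2 / ((p / 3) * (δ * Real.log p)) := by
    field_simp; norm_num
  rw [this]
  have : (p : ℝ) / 3 ≤ p - 2 := by linarith
  have : (0 : ℝ) ≤ p - 2 := by linarith
  gcongr

lemma sg_main (δ : ℝ) (hδ : 0 < δ) (hK : 16 ≤ Real.log (6 / δ)) (s : ℂ) (hs : δ ≤ s.re + 1) :
    ‖singG s‖ ≤ Real.exp (72 * (6 / δ) / Real.log (6 / δ)) := by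
  unfold singG
  by_cases hm : Multipliable (fun p : {p : ℕ // p.Prime ∧ 2 < p} =>
    (1 + 2 / (((p.1 : ℂ) - 2) * ((p.1 : ℂ) ^ (s + 1) + 1))))
  · have ht := hm.hasProd.norm
    refine le_of_tendsto ht (Filter.Eventually.of_forall fun S => ?_)
    have h1 := sg_prod (6 / δ) (by positivity) hK (S.map (Function.Embedding.subtype _)) (by
      intro p hp
      rw [Finset.mem_map] at hp
      obtain ⟨q, _, rfl⟩ := hp
      exact q.2)
    rw [Finset.prod_map] at h1
    refine le_trans ?_ h1
    apply Finset.prod_le_prod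
    · intro p _; exact norm_nonneg _
    · intro p _; exact sg_factor δ hδ s hs p.1 p.2.2
  · rw [tprod_eq_one_of_not_multipliable hm, norm_one]
    apply Real.one_le_exp
    have : 0 ≤ Real.log (6 / δ) := by linarith
    positivity

lemma sg_final (a : ℝ) (ha : 0 < a) (T : ℝ) (hT : Real.exp (Real.exp 32 + (a / 6) ^ 2) ≤ T)
    (s : ℂ) (hs : -1 + a / Real.log T ≤ s.re) :
    ‖singG s‖ ≤ Real.exp (864 / a * Real.log T / Real.log (Real.log T)) := by
  have hTpos : 0 < T := lt_of_lt_of_le (Real.exp_pos _) hT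
  have hL : Real.exp 32 + (a / 6) ^ 2 ≤ Real.log T := (Real.le_log_iff_exp_le hTpos).mpr hT
  set L := Real.log T with hLdef
  have he := Real.exp_pos 32
  have hL0 : 0 < L := by nlinarith [sq_nonneg (a / 6)]
  have hLL : 32 ≤ Real.log L := by
    rw [Real.le_log_iff_exp_le hL0]; nlinarith [sq_nonneg (a / 6)]
  have hK : 6 / (a / L) = 6 / a * L := by field_simp
  have hlogK : Real.log L / 2 ≤ Real.log (6 / (a / L)) := by
    rw [hK, Real.log_mul (by positivity) hL0.ne']
    have h1 : Real.log ((a / 6) ^ 2) ≤ Real.log L :=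
      Real.log_le_log (by positivity) (by linarith)
    rw [Real.log_pow] at h1
    have h2 : Real.log (6 / a) = - Real.log (a / 6) := by
      rw [← Real.log_inv, inv_div]
    push_cast at h1
    linarith
  have := sg_main (a / L) (by positivity) (by linarith) s (by linarith)
  refine this.trans (Real.exp_le_exp.mpr ?_)
  calc _ ≤ 72 * (6 / (a / L)) / (Real.log L / 2) := by
        apply div_le_div_of_nonneg_left (by positivity) (by linarith) hlogK
    _ = _ := by rw [hK]; field_simp; norm_num

/-- With `b = -1 + a/log T` (`a > 0` fixed, `T` large), uniformly for
`b ≤ Re(s) ≤ 2` one has `|G(s)| ≤ exp(B log T / log log T)` for a constant `B = B(a)`;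
in particular `G(s) ≪_ε T^ε`. -/
theorem singG_bound_near_minus_one (a : ℝ) (ha : 0 < a) :
    (∃ B : ℝ, 0 < B ∧ ∃ T₀ : ℝ, ∀ T : ℝ, T₀ ≤ T →
      ∀ s : ℂ, -1 + a / Real.log T ≤ s.re → s.re ≤ 2 →
        ‖singG s‖ ≤ Real.exp (B * Real.log T / Real.log (Real.log T))) ∧
    (∀ ε : ℝ, 0 < ε → ∃ T₁ : ℝ, ∀ T : ℝ, T₁ ≤ T →
      ∀ s : ℂ, -1 + a / Real.log T ≤ s.re → s.re ≤ 2 →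
        ‖singG s‖ ≤ T ^ ε) := by
  refine ⟨⟨864 / a, by positivity, _, fun T hT s hs _ => sg_final a ha T hT s hs⟩, ?_⟩
  intro ε hε
  refine ⟨max (Real.exp (Real.exp 32 + (a / 6) ^ 2)) (Real.exp (Real.exp (864 / a / ε))), ?_⟩
  intro T hT s hs _
  have hT1 := (le_max_left _ _).trans hT
  have hT2 := (le_max_right _ _).trans hT
  have hTpos : 0 < T := lt_of_lt_of_le (Real.exp_pos _) hT1
  refine (sg_final a ha T hT1 s hs).trans ?_
  rw [Real.rpow_def_of_pos hTpos]
  apply Real.exp_le_exp.mpr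
  have hL := (Real.le_log_iff_exp_le hTpos).mpr hT2
  have hL0 : 0 < Real.log T := lt_of_lt_of_le (Real.exp_pos _) hL
  have hLL := (Real.le_log_iff_exp_le hL0).mpr hL
  have hq : 0 < 864 / a / ε := by positivity
  rw [div_le_iff₀ (lt_of_lt_of_le hq hLL)]
  rw [div_le_iff₀ hε] at hLL
  nlinarith

end
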